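/- Fix ε ∈ [0,1). For any general source X and any ε₁, ε₂ ≥ 0 satisfying ε₁ + ε₂ = ε, it holds that H̃_{ε₁,ε₂}(X) = H̄_ε(X). -/

import Mathlib

open Filter MeasureTheory

namespace NY

/-- A probability distribution on a set, given by its point mass function. -/
structure Dist (α : Type*) where
  p : α → ℝ
  nonneg : ∀ x, 0 ≤ p x
  hasSum : HasSum p 1

/-- The probability of a set under a distribution. -/
noncomputable def Dist.pr {α : Type*} (P : Dist α) (A : Set α) : ℝ := ∑' x : A, P.p x.1

/-- 𝒰* : nonempty finite strings over the code alphabet 𝒰 = {1,…,K}. -/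
abbrev Word (K : ℕ) := {u : List (Fin K) // u ≠ []}

/-- Length of a string, as a real number. -/
noncomputable def wlen {K : ℕ} (u : Word K) : ℝ := u.1.length

/-- Error probability of a variable-length code (φ, ψ). -/
noncomputable def errP {α : Type*} {K : ℕ} (P : Dist α) (φ : α → Word K) (ψ : Word K → α) : ℝ :=
  P.pr {x | ψ (φ x) ≠ x}

/-- Overflow probability of an encoder φ with threshold η. -/
noncomputable def ovP {α : Type*} {K : ℕ} (P : Dist α) (φ : α → Word K) (η : ℝ) : ℝ :=
  P.pr {x | wlen (φ x) > η}

/-- A general source: for each blocklength n, a distribution on 𝒳^n. -/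
abbrev Source (𝒳 : Type*) := (n : ℕ) → Dist (Fin n → 𝒳)

/-- The limit as ν ↓ 0 of a function g which is nonincreasing in ν
(the limit exists by monotonicity and equals the supremum over ν > 0). -/
noncomputable def limNu (g : ℝ → ℝ) : ℝ := sSup (g '' Set.Ioi (0 : ℝ))

variable {𝒳 : Type*}

/-- A rate R ≥ 0 is (ε,δ)-achievable. -/
def FirstAch (K : ℕ) (X : Source 𝒳) (ε δ R : ℝ) : Prop :=
  0 ≤ R ∧ ∃ (φ : ∀ n, (Fin n → 𝒳) → Word K) (ψ : ∀ n, Word K → (Fin n → 𝒳)),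
    limsup (fun n => errP (X n) (φ n) (ψ n)) atTop ≤ ε ∧
    limsup (fun n => ovP (X n) (φ n) ((n : ℝ) * R)) atTop ≤ δ

/-- The first-order (ε,δ)-optimum threshold R(ε,δ|X). -/
noncomputable def Ropt (K : ℕ) (X : Source 𝒳) (ε δ : ℝ) : ℝ :=
  sInf {R | FirstAch K X ε δ R}

/-- L is (ε,δ,R)-achievable (second order). -/
def SecondAch (K : ℕ) (X : Source 𝒳) (ε δ R L : ℝ) : Prop :=
  ∃ (φ : ∀ n, (Fin n → 𝒳) → Word K) (ψ : ∀ n, Word K → (Fin n → 𝒳)),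
    limsup (fun n => errP (X n) (φ n) (ψ n)) atTop ≤ ε ∧
    limsup (fun n => ovP (X n) (φ n) ((n : ℝ) * R + Real.sqrt (n : ℝ) * L)) atTop ≤ δ

/-- The second-order (ε,δ,R)-optimum threshold L(ε,δ,R|X). -/
noncomputable def Lopt (K : ℕ) (X : Source 𝒳) (ε δ R : ℝ) : ℝ :=
  sInf {L | SecondAch K X ε δ R L}

/-- A rate R ≥ 0 is optimistically (ε,δ)-achievable. -/
def OptFirstAch (K : ℕ) (X : Source 𝒳) (ε δ R : ℝ) : Prop :=
  0 ≤ R ∧ ∃ (φ : ∀ n, (Fin n → 𝒳) → Word K) (ψ : ∀ n, Word K → (Fin n → 𝒳)),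
    ∀ γ > (0 : ℝ), ∃ ns : ℕ → ℕ, StrictMono ns ∧ ∀ i,
      errP (X (ns i)) (φ (ns i)) (ψ (ns i)) ≤ ε + γ ∧
      ovP (X (ns i)) (φ (ns i)) ((ns i : ℝ) * R) ≤ δ + γ

/-- The optimistic first-order (ε,δ)-optimum threshold R*(ε,δ|X). -/
noncomputable def RoptStar (K : ℕ) (X : Source 𝒳) (ε δ : ℝ) : ℝ :=
  sInf {R | OptFirstAch K X ε δ R}

/-- L is optimistically (ε,δ,R)-achievable. -/
def OptSecondAch (K : ℕ) (X : Source 𝒳) (ε δ R L : ℝ) : Prop :=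
  ∃ (φ : ∀ n, (Fin n → 𝒳) → Word K) (ψ : ∀ n, Word K → (Fin n → 𝒳)),
    ∀ γ > (0 : ℝ), ∃ ns : ℕ → ℕ, StrictMono ns ∧ ∀ i,
      errP (X (ns i)) (φ (ns i)) (ψ (ns i)) ≤ ε + γ ∧
      ovP (X (ns i)) (φ (ns i)) ((ns i : ℝ) * R + Real.sqrt (ns i : ℝ) * L) ≤ δ + γ

/-- The optimistic second-order (ε,δ,R)-optimum threshold L*(ε,δ,R|X). -/
noncomputable def LoptStar (K : ℕ) (X : Source 𝒳) (ε δ R : ℝ) : ℝ :=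
  sInf {L | OptSecondAch K X ε δ R L}

/-- A rate R ≥ 0 is type I (ε,δ)-achievable. -/
def TypeIAch (K : ℕ) (X : Source 𝒳) (ε δ R : ℝ) : Prop :=
  0 ≤ R ∧ ∃ (φ : ∀ n, (Fin n → 𝒳) → Word K) (ψ : ∀ n, Word K → (Fin n → 𝒳)),
    limsup (fun n => errP (X n) (φ n) (ψ n)) atTop ≤ ε ∧
    liminf (fun n => ovP (X n) (φ n) ((n : ℝ) * R)) atTop ≤ δ

/-- R†(ε,δ|X). -/
noncomputable def Rdagger (K : ℕ) (X : Source 𝒳) (ε δ : ℝ) : ℝ :=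
  sInf {R | TypeIAch K X ε δ R}

/-- A rate R ≥ 0 is type II (ε,δ)-achievable. -/
def TypeIIAch (K : ℕ) (X : Source 𝒳) (ε δ R : ℝ) : Prop :=
  0 ≤ R ∧ ∃ (φ : ∀ n, (Fin n → 𝒳) → Word K) (ψ : ∀ n, Word K → (Fin n → 𝒳)),
    liminf (fun n => errP (X n) (φ n) (ψ n)) atTop ≤ ε ∧
    limsup (fun n => ovP (X n) (φ n) ((n : ℝ) * R)) atTop ≤ δ

/-- R‡(ε,δ|X). -/
noncomputable def Rddagger (K : ℕ) (X : Source 𝒳) (ε δ : ℝ) : ℝ :=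
  sInf {R | TypeIIAch K X ε δ R}

/-- H̄_γ(X) := inf{ R : limsup_n Pr{ (1/n) log(1/P_{X^n}(X^n)) > R } ≤ γ }. -/
noncomputable def Hbar (K : ℕ) (X : Source 𝒳) (γ : ℝ) : ℝ :=
  sInf {R | limsup (fun n =>
    (X n).pr {x | Real.logb (K : ℝ) (1 / (X n).p x) / (n : ℝ) > R}) atTop ≤ γ}

/-- H̄*_γ(X) (optimistic version, with liminf). -/
noncomputable def HbarStar (K : ℕ) (X : Source 𝒳) (γ : ℝ) : ℝ :=
  sInf {R | liminf (fun n =>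
    (X n).pr {x | Real.logb (K : ℝ) (1 / (X n).p x) / (n : ℝ) > R}) atTop ≤ γ}

/-- H̄_γ(R|X) := inf{ L : limsup_n Pr{ (1/n) log(1/P_{X^n}(X^n)) > R + L/√n } ≤ γ }. -/
noncomputable def Hbar2 (K : ℕ) (X : Source 𝒳) (γ R : ℝ) : ℝ :=
  sInf {L | limsup (fun n =>
    (X n).pr {x | Real.logb (K : ℝ) (1 / (X n).p x) / (n : ℝ)
      > R + L / Real.sqrt (n : ℝ)}) atTop ≤ γ}

/-- H̄*_γ(R|X) (optimistic version, with liminf). -/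
noncomputable def Hbar2Star (K : ℕ) (X : Source 𝒳) (γ R : ℝ) : ℝ :=
  sInf {L | liminf (fun n =>
    (X n).pr {x | Real.logb (K : ℝ) (1 / (X n).p x) / (n : ℝ)
      > R + L / Real.sqrt (n : ℝ)}) atTop ≤ γ}

/-- F(ε,R) := limsup_n inf_{A : Pr(A) ≥ 1−ε} Pr{ −(1/n) log P_{X^n}(X^n) ≥ R, X^n ∈ A }. -/
noncomputable def Fspec (K : ℕ) (X : Source 𝒳) (ε R : ℝ) : ℝ :=
  limsup (fun n =>
    sInf ((fun A : Set (Fin n → 𝒳) =>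
        (X n).pr (A ∩ {x | -Real.logb (K : ℝ) ((X n).p x) / (n : ℝ) ≥ R})) ''
      {A | (X n).pr A ≥ 1 - ε})) atTop

/-- H̃_{ε,δ}(X) := inf{ R : F(ε,R) ≤ δ }. -/
noncomputable def Htilde (K : ℕ) (X : Source 𝒳) (ε δ : ℝ) : ℝ :=
  sInf {R | Fspec K X ε R ≤ δ}

/-- G_{ε,δ}(X). -/
noncomputable def Gfirst (K : ℕ) (X : Source 𝒳) (ε δ : ℝ) : ℝ :=
  sInf {R | limNu (fun ν => limsup (fun n =>
    sInf ((fun A : Set (Fin n → 𝒳) =>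
        (X n).pr (A ∩ {x | -Real.logb (K : ℝ) ((X n).p x / (X n).pr A) / (n : ℝ) ≥ R})) ''
      {A | (X n).pr A ≥ 1 - ε - ν})) atTop) ≤ δ}

/-- G*_{ε,δ}(X) (optimistic version, with liminf). -/
noncomputable def GfirstStar (K : ℕ) (X : Source 𝒳) (ε δ : ℝ) : ℝ :=
  sInf {R | limNu (fun ν => liminf (fun n =>
    sInf ((fun A : Set (Fin n → 𝒳) =>
        (X n).pr (A ∩ {x | -Real.logb (K : ℝ) ((X n).p x / (X n).pr A) / (n : ℝ) ≥ R})) ''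
      {A | (X n).pr A ≥ 1 - ε - ν})) atTop) ≤ δ}

/-- G_{ε,δ}(R|X). -/
noncomputable def Gsecond (K : ℕ) (X : Source 𝒳) (ε δ R : ℝ) : ℝ :=
  sInf {L | limNu (fun ν => limsup (fun n =>
    sInf ((fun A : Set (Fin n → 𝒳) =>
        (X n).pr (A ∩ {x | -Real.logb (K : ℝ) ((X n).p x / (X n).pr A) / (n : ℝ)
          ≥ R + L / Real.sqrt (n : ℝ)})) ''
      {A | (X n).pr A ≥ 1 - ε - ν})) atTop) ≤ δ}

/-- G*_{ε,δ}(R|X) (optimistic version, with liminf). -/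
noncomputable def GsecondStar (K : ℕ) (X : Source 𝒳) (ε δ R : ℝ) : ℝ :=
  sInf {L | limNu (fun ν => liminf (fun n =>
    sInf ((fun A : Set (Fin n → 𝒳) =>
        (X n).pr (A ∩ {x | -Real.logb (K : ℝ) ((X n).p x / (X n).pr A) / (n : ℝ)
          ≥ R + L / Real.sqrt (n : ℝ)})) ''
      {A | (X n).pr A ≥ 1 - ε - ν})) atTop) ≤ δ}

/-- A rate R is optimistically ε-achievable by fixed-length codes. -/
def FixAchR (K : ℕ) (X : Source 𝒳) (ε R : ℝ) : Prop :=
  ∃ (M : ℕ → ℕ) (φ : ∀ n, (Fin n → 𝒳) → Fin (M n)) (ψ : ∀ n, Fin (M n) → (Fin n → 𝒳)),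
    ∀ γ > (0 : ℝ), ∃ ns : ℕ → ℕ, StrictMono ns ∧ ∀ i,
      (X (ns i)).pr {x | ψ (ns i) (φ (ns i) x) ≠ x} ≤ ε + γ ∧
      Real.logb (K : ℝ) (M (ns i) : ℝ) / (ns i : ℝ) ≤ R + γ

/-- R^f(ε|X). -/
noncomputable def Rfix (K : ℕ) (X : Source 𝒳) (ε : ℝ) : ℝ :=
  sInf {R | FixAchR K X ε R}

/-- A real L is optimistically (ε,R)-achievable by fixed-length codes. -/
def FixAchL (K : ℕ) (X : Source 𝒳) (ε R L : ℝ) : Prop :=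
  ∃ (M : ℕ → ℕ) (φ : ∀ n, (Fin n → 𝒳) → Fin (M n)) (ψ : ∀ n, Fin (M n) → (Fin n → 𝒳)),
    ∀ γ > (0 : ℝ), ∃ ns : ℕ → ℕ, StrictMono ns ∧ ∀ i,
      (X (ns i)).pr {x | ψ (ns i) (φ (ns i) x) ≠ x} ≤ ε + γ ∧
      Real.logb (K : ℝ) ((M (ns i) : ℝ) / (K : ℝ) ^ ((ns i : ℝ) * R)) / Real.sqrt (ns i : ℝ)
        ≤ L + γ

/-- L^f(ε,R|X). -/
noncomputable def Lfix (K : ℕ) (X : Source 𝒳) (ε R : ℝ) : ℝ :=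
  sInf {L | FixAchL K X ε R L}

lemma lims_iff (u : ℕ → ℝ) (h0 : ∀ n, 0 ≤ u n) (h1 : ∀ n, u n ≤ 1) (c : ℝ) :
    limsup u atTop ≤ c ↔ ∀ γ > (0 : ℝ), ∀ᶠ n in atTop, u n ≤ c + γ := by
  have hb : IsBoundedUnder (· ≤ ·) atTop u := isBoundedUnder_of ⟨1, h1⟩
  have hc : IsCoboundedUnder (· ≤ ·) atTop u :=
    (isBoundedUnder_of (r := (· ≥ ·)) ⟨0, h0⟩).isCoboundedUnder_le
  constructor
  · intro h γ hγ
    filter_upwards [eventually_lt_of_limsup_lt (lt_of_le_of_lt h (lt_add_of_pos_right c hγ)) hb]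
      with n hn using hn.le
  · intro h
    refine le_of_forall_pos_le_add fun γ hγ => ?_
    exact limsup_le_of_le hc (h γ hγ)

section prl
variable {α : Type*} (P : Dist α)

lemma pr_eq (A : Set α) : P.pr A = ∑' x, A.indicator P.p x := tsum_subtype A P.p

lemma ind_summable (A : Set α) : Summable (A.indicator P.p) := P.hasSum.summable.indicator A

lemma pr_univ : P.pr Set.univ = 1 := by
  rw [pr_eq]; simp [P.hasSum.tsum_eq]

lemma pr_nonneg (A : Set α) : 0 ≤ P.pr A := tsum_nonneg fun x => P.nonneg _

/-- monotonicity up to null points -/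
lemma pr_mono' {A B : Set α} (h : ∀ x ∈ A, P.p x ≠ 0 → x ∈ B) : P.pr A ≤ P.pr B := by
  rw [pr_eq, pr_eq]
  refine (ind_summable P A).tsum_le_tsum (fun x => ?_) (ind_summable P B)
  by_cases hA : x ∈ A
  · by_cases hp : P.p x = 0
    · simp [Set.indicator, hp]
    · simp [Set.indicator, hA, h x hA hp]
  · simp only [Set.indicator_of_notMem hA]
    exact Set.indicator_nonneg (fun x _ => P.nonneg x) x

lemma pr_mono {A B : Set α} (h : A ⊆ B) : P.pr A ≤ P.pr B := pr_mono' P fun _ hx _ => h hx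

lemma pr_le_one (A : Set α) : P.pr A ≤ 1 := by
  rw [← pr_univ P]; exact pr_mono P (Set.subset_univ _)

lemma pr_split (A B : Set α) : P.pr (A ∩ B) + P.pr (A \ B) = P.pr A := by
  rw [pr_eq, pr_eq, pr_eq, ← (ind_summable P _).tsum_add (ind_summable P _)]
  congr 1; ext x
  by_cases hA : x ∈ A <;> by_cases hB : x ∈ B <;> simp [Set.indicator, hA, hB]

lemma pr_finset (S : Finset α) : P.pr (S : Set α) = ∑ x ∈ S, P.p x := by
  unfold Dist.pr; exact Finset.tsum_subtype S P.p

lemma greedy_fin (t e : ℝ) (he : 0 ≤ e) (ht : 0 ≤ t) (S : Finset α) :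
    (∀ x ∈ S, P.p x ≤ t) → ∃ C ⊆ S, ∑ x ∈ C, P.p x ≤ e ∧
      ∑ x ∈ S, P.p x - ∑ x ∈ C, P.p x ≤ max (∑ x ∈ S, P.p x - e) 0 + t := by
  classical
  induction S using Finset.induction_on with
  | empty => intro _; exact ⟨∅, by simp, by simpa using he, by simp; positivity⟩
  | insert a S ha ih =>
    intro h
    obtain ⟨C, hCS, h1, h2⟩ := ih fun x hx => h x (Finset.mem_insert_of_mem hx)
    have hat := h a (Finset.mem_insert_self _ _)
    have h0 := P.nonneg a
    rw [Finset.sum_insert ha]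
    by_cases hc : ∑ x ∈ C, P.p x + P.p a ≤ e
    · refine ⟨insert a C, Finset.insert_subset_insert a hCS, ?_, ?_⟩
      · rw [Finset.sum_insert fun hh => ha (hCS hh)]; linarith
      · rw [Finset.sum_insert fun hh => ha (hCS hh)]
        have : max (∑ x ∈ S, P.p x - e) 0 ≤ max (P.p a + ∑ x ∈ S, P.p x - e) 0 :=
          max_le_max (by linarith) le_rfl
        linarith
    · refine ⟨C, hCS.trans (Finset.subset_insert _ _), h1, ?_⟩
      have := le_max_left (P.p a + ∑ x ∈ S, P.p x - e) 0
      push Not at hc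
      linarith

lemma greedy (t e : ℝ) (he : 0 ≤ e) (ht : 0 < t) (B : Set α) (hB : ∀ x ∈ B, P.p x ≤ t) :
    ∃ C ⊆ B, P.pr C ≤ e ∧ P.pr (B \ C) ≤ max (P.pr B - e) 0 + 2 * t := by
  classical
  have hs : HasSum (B.indicator P.p) (P.pr B) := by
    rw [pr_eq]; exact (ind_summable P B).hasSum
  obtain ⟨S, hS⟩ := (hs.eventually (lt_mem_nhds (show P.pr B - t < P.pr B by linarith))).exists
  have hS2 : ∑ x ∈ S.filter (· ∈ B), P.p x = ∑ x ∈ S, B.indicator P.p x := by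
    rw [Finset.sum_filter]; rfl
  rw [← hS2] at hS
  have hsub : ((S.filter (· ∈ B) : Finset α) : Set α) ⊆ B := by
    intro x hx; simp at hx; exact hx.2
  have hle : ∑ x ∈ S.filter (· ∈ B), P.p x ≤ P.pr B := by
    rw [← pr_finset]; exact pr_mono P hsub
  obtain ⟨C, hC, h1, h2⟩ := greedy_fin P t e he ht.le (S.filter (· ∈ B))
    fun x hx => hB x (hsub hx)
  have hCB : (C : Set α) ⊆ B := fun x hx => hsub (hC hx)
  refine ⟨C, hCB, by rwa [pr_finset], ?_⟩
  have h3 := pr_split P B C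
  rw [Set.inter_eq_right.2 hCB, pr_finset] at h3
  have : max (∑ x ∈ S.filter (· ∈ B), P.p x - e) 0 ≤ max (P.pr B - e) 0 :=
    max_le_max (by linarith) le_rfl
  linarith

/-- the inner infimum -/
noncomputable def infA (B : Set α) (e : ℝ) : ℝ :=
  sInf ((fun A : Set α => P.pr (A ∩ B)) '' {A | P.pr A ≥ 1 - e})

lemma infA_bdd (B : Set α) (e : ℝ) :
    BddBelow ((fun A : Set α => P.pr (A ∩ B)) '' {A | P.pr A ≥ 1 - e}) :=
  ⟨0, by rintro _ ⟨A, -, rfl⟩; exact pr_nonneg P _⟩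

lemma infA_le (B : Set α) (e : ℝ) (A : Set α) (hA : P.pr A ≥ 1 - e) :
    infA P B e ≤ P.pr (A ∩ B) := csInf_le (infA_bdd P B e) ⟨A, hA, rfl⟩

lemma le_infA (B : Set α) (e : ℝ) (he : 0 ≤ e) (c : ℝ)
    (h : ∀ A : Set α, P.pr A ≥ 1 - e → c ≤ P.pr (A ∩ B)) : c ≤ infA P B e := by
  refine le_csInf ⟨_, Set.univ, ?_, rfl⟩ ?_
  · simp [pr_univ, he]
  · rintro _ ⟨A, hA, rfl⟩; exact h A hA

lemma infA_nonneg (B : Set α) (e : ℝ) (he : 0 ≤ e) : 0 ≤ infA P B e :=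
  le_infA P B e he 0 fun _ _ => pr_nonneg P _

lemma infA_le_one (B : Set α) (e : ℝ) (he : 0 ≤ e) : infA P B e ≤ 1 :=
  (infA_le P B e Set.univ (by simp [pr_univ, he])).trans (pr_le_one P _)

lemma pr_sub_le_infA (B : Set α) (e : ℝ) (he : 0 ≤ e) : P.pr B - e ≤ infA P B e := by
  refine le_infA P B e he _ fun A hA => ?_
  have h1 := pr_split P B A
  have h2 := pr_split P Set.univ A
  rw [pr_univ, Set.univ_inter] at h2
  have h3 : P.pr (B \ A) ≤ P.pr (Set.univ \ A) := pr_mono P fun x hx => ⟨trivial, hx.2⟩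
  rw [Set.inter_comm]
  linarith

lemma infA_upper (B : Set α) (e t : ℝ) (he : 0 ≤ e) (ht : 0 < t) (hB : ∀ x ∈ B, P.p x ≤ t) :
    infA P B e ≤ max (P.pr B - e) 0 + 2 * t := by
  obtain ⟨C, hCB, h1, h2⟩ := greedy P t e he ht B hB
  have h3 := pr_split P Set.univ C
  rw [pr_univ, Set.univ_inter] at h3
  refine (infA_le P B e (Set.univ \ C) (by linarith)).trans (le_trans (pr_mono P ?_) h2)
  rintro x ⟨hx, hxB⟩; exact ⟨hxB, hx.2⟩

end prl

lemma sInf_eq_aux (S T : Set ℝ) (hST : S ⊆ T) (hT : ∀ R ∈ T, 0 ≤ R)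
    (hTS : ∀ R ∈ T, ∀ R' > R, R' ∈ S) : sInf S = sInf T := by
  rcases T.eq_empty_or_nonempty with rfl | hne
  · rw [Set.subset_empty_iff.1 hST]
  obtain ⟨R, hR⟩ := hne
  have hSne : S.Nonempty := ⟨R + 1, hTS R hR _ (by linarith)⟩
  refine le_antisymm ?_ (csInf_le_csInf ⟨0, hT⟩ hSne hST)
  refine le_csInf ⟨R, hR⟩ fun Q hQ => le_of_forall_gt_imp_ge_of_dense fun Q' hQ' => ?_
  exact csInf_le ⟨0, fun x hx => hT x (hST hx)⟩ (hTS Q hQ Q' hQ')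

/-- for ε₁ + ε₂ = ε, H̃_{ε₁,ε₂}(X) = H̄_ε(X). -/
theorem statement9 {𝒳 : Type*} [Countable 𝒳] (K : ℕ) (hK : 2 ≤ K) (X : Source 𝒳)
    (ε ε₁ ε₂ : ℝ) (hε0 : 0 ≤ ε) (hε1 : ε < 1)
    (h₁ : 0 ≤ ε₁) (h₂ : 0 ≤ ε₂) (hsum : ε₁ + ε₂ = ε) :
    Htilde K X ε₁ ε₂ = Hbar K X ε := by
  have hK1 : (1 : ℝ) < K := by exact_mod_cast hK
  unfold Htilde Hbar
  apply sInf_eq_aux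
  · intro R hR
    simp only [Set.mem_setOf_eq] at hR ⊢
    have hR' := (lims_iff (fun n => infA (X n)
      {x | -Real.logb (K : ℝ) ((X n).p x) / (n : ℝ) ≥ R} ε₁)
      (fun n => infA_nonneg _ _ _ h₁) (fun n => infA_le_one _ _ _ h₁) ε₂).1 hR
    rw [lims_iff _ (fun n => pr_nonneg _ _) (fun n => pr_le_one _ _)]
    intro γ hγ
    filter_upwards [hR' γ hγ] with n hn
    have h1 := pr_sub_le_infA (X n) {x | -Real.logb (K : ℝ) ((X n).p x) / (n : ℝ) ≥ R} ε₁ h₁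
    have h2 : (X n).pr {x | Real.logb (K : ℝ) (1 / (X n).p x) / (n : ℝ) > R} ≤
        (X n).pr {x | -Real.logb (K : ℝ) ((X n).p x) / (n : ℝ) ≥ R} := by
      apply pr_mono
      intro x hx
      simp only [Set.mem_setOf_eq, one_div, Real.logb_inv] at hx ⊢
      exact hx.le
    linarith
  · intro R hR
    by_contra hneg
    push Not at hneg
    simp only [Set.mem_setOf_eq] at hR
    rw [lims_iff _ (fun n => pr_nonneg _ _) (fun n => pr_le_one _ _)] at hR
    obtain ⟨n, hn⟩ := (hR ((1 - ε) / 2) (by linarith)).exists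
    have h1 : (X n).pr Set.univ ≤
        (X n).pr {x | Real.logb (K : ℝ) (1 / (X n).p x) / (n : ℝ) > R} := by
      apply pr_mono'
      intro x _ hp
      simp only [Set.mem_setOf_eq, one_div, Real.logb_inv]
      have hle : (X n).p x ≤ 1 := le_hasSum (X n).hasSum x fun y _ => (X n).nonneg y
      have := Real.logb_nonpos hK1 ((X n).nonneg x) hle
      have : 0 ≤ -Real.logb (K : ℝ) ((X n).p x) / (n : ℝ) :=
        div_nonneg (by linarith) (Nat.cast_nonneg n)
      linarith
    rw [pr_univ] at h1
    linarith
  · intro R hR R' hRR'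
    have hR0 : 0 < R' := by
      by_contra hneg
      push Not at hneg
      simp only [Set.mem_setOf_eq] at hR
      rw [lims_iff _ (fun n => pr_nonneg _ _) (fun n => pr_le_one _ _)] at hR
      obtain ⟨n, hn⟩ := (hR ((1 - ε) / 2) (by linarith)).exists
      have h1 : (X n).pr Set.univ ≤
          (X n).pr {x | Real.logb (K : ℝ) (1 / (X n).p x) / (n : ℝ) > R} := by
        apply pr_mono'
        intro x _ hp
        simp only [Set.mem_setOf_eq, one_div, Real.logb_inv]
        have hle : (X n).p x ≤ 1 := le_hasSum (X n).hasSum x fun y _ => (X n).nonneg y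
        have := Real.logb_nonpos hK1 ((X n).nonneg x) hle
        have : 0 ≤ -Real.logb (K : ℝ) ((X n).p x) / (n : ℝ) :=
          div_nonneg (by linarith) (Nat.cast_nonneg n)
        linarith
      rw [pr_univ] at h1
      linarith
    simp only [Set.mem_setOf_eq] at hR ⊢
    rw [lims_iff _ (fun n => pr_nonneg _ _) (fun n => pr_le_one _ _)] at hR
    refine (lims_iff (fun n => infA (X n)
      {x | -Real.logb (K : ℝ) ((X n).p x) / (n : ℝ) ≥ R'} ε₁)
      (fun n => infA_nonneg _ _ _ h₁) (fun n => infA_le_one _ _ _ h₁) ε₂).2 ?_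
    intro γ hγ
    have hlim : Tendsto (fun n : ℕ => ((K : ℝ) ^ (-R')) ^ n) atTop (nhds 0) :=
      tendsto_pow_atTop_nhds_zero_of_lt_one (by positivity)
        (Real.rpow_lt_one_of_one_lt_of_neg hK1 (by linarith))
    filter_upwards [hR (γ / 2) (by linarith), eventually_gt_atTop 0,
      hlim.eventually (gt_mem_nhds (show (0 : ℝ) < γ / 4 by linarith))] with n hn hn0 hnt
    have hn0' : (0 : ℝ) < n := by exact_mod_cast hn0
    have hKpos : (0 : ℝ) < K := by linarith
    have h1 := infA_upper (X n) {x | -Real.logb (K : ℝ) ((X n).p x) / (n : ℝ) ≥ R'} ε₁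
      (((K : ℝ) ^ (-R')) ^ n) h₁ (by positivity) (by
        intro x hx
        simp only [Set.mem_setOf_eq, ge_iff_le] at hx
        rw [le_div_iff₀ hn0'] at hx
        rw [← Real.rpow_natCast, ← Real.rpow_mul hKpos.le]
        rcases ((X n).nonneg x).eq_or_lt with h0 | h0
        · rw [← h0]; positivity
        · exact (Real.logb_le_iff_le_rpow hK1 h0).1 (by linarith))
    have h2 : (X n).pr {x | -Real.logb (K : ℝ) ((X n).p x) / (n : ℝ) ≥ R'} ≤
        (X n).pr {x | Real.logb (K : ℝ) (1 / (X n).p x) / (n : ℝ) > R} := by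
      apply pr_mono
      intro x hx
      simp only [Set.mem_setOf_eq, one_div, Real.logb_inv] at hx ⊢
      exact lt_of_lt_of_le hRR' hx
    have h3 : max ((X n).pr {x | -Real.logb (K : ℝ) ((X n).p x) / (n : ℝ) ≥ R'} - ε₁) 0
        ≤ ε₂ + γ / 2 := max_le (by linarith) (by linarith)
    linarith
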